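/- Let k ≥ 1 be an integer and z a complex number with 0 < |z| < 1. Set L = log|z|² (a real number), let Li_j(z) = Σ_{n≥1} z^n/n^j, define Li_k^-(z) = Li_k(z) − Σ_{a=0}^{k−1} (−1)^{k−a}·(L^a/a!)·Li_{k−a}(z̄) (with z̄ the complex conjugate of z), and define Zagier's function P_k(z) = ℜ_k( Σ_{a=0}^{k−1} (B_a/a!)·L^a·Li_{k−a}(z) ), where ℜ_k denotes the real part if k is odd and the imaginary part if k is even, and B_a are the Bernoulli numbers with generating function t/(e^t−1) = Σ_{n≥0} B_n t^n/n! (so B₁ = −1/2). Then P_k(z) = ℜ_k( (1/2)·Σ_{i=0}^{k−1} (B_i/i!)·L^i·Li_{k−i}^-(z) ). -/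

import Mathlib

/-- The classical polylogarithm `Li_j(z) = Σ_{n≥1} z^n/n^j`. -/
noncomputable def cLi (j : ℕ) (z : ℂ) : ℂ :=
  ∑' n : ℕ+, z ^ (n : ℕ) / ((n : ℕ) : ℂ) ^ j

/-- `ℜ_k`: the real part if `k` is odd, the imaginary part if `k` is even. -/
noncomputable def ReK (k : ℕ) (w : ℂ) : ℝ :=
  if Odd k then w.re else w.im

/-- The single-valued polylogarithm
`Li_k^-(z) = Li_k(z) − Σ_{a=0}^{k−1} (−1)^{k−a}·(L^a/a!)·Li_{k−a}(z̄)`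
with `L = log|z|²`. -/
noncomputable def LiMinus (k : ℕ) (z : ℂ) : ℂ :=
  cLi k z - ∑ a ∈ Finset.range k,
    (-1 : ℂ) ^ (k - a) * ((Real.log (‖z‖ ^ 2) : ℂ) ^ a / (a.factorial : ℂ)) *
      cLi (k - a) ((starRingEnd ℂ) z)

/-- Zagier's single-valued polylogarithm
`P_k(z) = ℜ_k( Σ_{a=0}^{k−1} (B_a/a!)·L^a·Li_{k−a}(z) )` with `L = log|z|²`
and `B_a` the Bernoulli numbers with `t/(e^t−1) = Σ B_n t^n/n!`. -/
noncomputable def zagierP (k : ℕ) (z : ℂ) : ℝ :=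
  ReK k (∑ a ∈ Finset.range k,
    ((bernoulli a : ℂ) / (a.factorial : ℂ)) * (Real.log (‖z‖ ^ 2) : ℂ) ^ a *
      cLi (k - a) z)

open Finset in
theorem sum_antidiagonal_bernoulli_div_factorial (m : ℕ) :
    ∑ p ∈ antidiagonal m, (bernoulli p.1 : ℂ) / (p.1.factorial : ℂ) * (1 / (p.2.factorial : ℂ)) =
      (-1) ^ m * ((bernoulli m : ℂ) / (m.factorial : ℂ)) := by
  have h : bernoulliPowerSeries ℂ * PowerSeries.exp ℂ = PowerSeries.X + bernoulliPowerSeries ℂ := by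
    linear_combination bernoulliPowerSeries_mul_exp_sub_one ℂ
  have hc := congrArg (PowerSeries.coeff m) h
  simp only [PowerSeries.coeff_mul, bernoulliPowerSeries, PowerSeries.coeff_mk,
    PowerSeries.coeff_exp, map_add, PowerSeries.coeff_X, eq_ratCast, Rat.cast_div, Rat.cast_one,
    Rat.cast_natCast] at hc
  rw [hc]
  rcases eq_or_ne m 1 with rfl | hm
  · norm_num [bernoulli_one]
  · rcases Nat.even_or_odd m with he | ho
    · simp [hm, he.neg_one_pow]
    · have h1 : 1 < m := by have := ho.pos; omega
      simp [hm, bernoulli_eq_zero_of_odd ho h1]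

theorem cLi_conj (j : ℕ) (z : ℂ) :
    cLi j ((starRingEnd ℂ) z) = (starRingEnd ℂ) (cLi j z) := by
  simp [cLi, Complex.conj_tsum]

/-- Twisting by `LiMinus` turns Zagier's Bernoulli sum `S` into `S - (-1) ^ k * conj S`. -/
theorem sum_bernoulli_mul_liMinus (k : ℕ) (z : ℂ) :
    ∑ i ∈ Finset.range k, ((bernoulli i : ℂ) / (i.factorial : ℂ)) *
        (Real.log (‖z‖ ^ 2) : ℂ) ^ i * LiMinus (k - i) z =
      (∑ i ∈ Finset.range k, ((bernoulli i : ℂ) / (i.factorial : ℂ)) *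
        (Real.log (‖z‖ ^ 2) : ℂ) ^ i * cLi (k - i) z) -
      (-1) ^ k * (starRingEnd ℂ) (∑ i ∈ Finset.range k,
        ((bernoulli i : ℂ) / (i.factorial : ℂ)) *
          (Real.log (‖z‖ ^ 2) : ℂ) ^ i * cLi (k - i) z) := by
  simp only [LiMinus, cLi_conj, mul_sub, Finset.sum_sub_distrib, map_sum, map_mul, map_pow,
    map_div₀, Complex.conj_ofReal, Complex.conj_natCast, map_ratCast]
  congr 1
  simp only [Finset.mul_sum]
  generalize (Real.log (‖z‖ ^ 2) : ℂ) = L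
  rw [← Finset.sum_range_diag_flip k fun i a ↦ (bernoulli i : ℂ) / (i.factorial : ℂ) * L ^ i *
    ((-1) ^ (k - i - a) * (L ^ a / (a.factorial : ℂ)) * (starRingEnd ℂ) (cLi (k - i - a) z))]
  refine Finset.sum_congr rfl fun m hm ↦ ?_
  have hmk : m < k := Finset.mem_range.mp hm
  have hsign : (-1 : ℂ) ^ k = (-1) ^ (k - m) * (-1) ^ m := by
    rw [← pow_add, Nat.sub_add_cancel hmk.le]
  calc _ = ∑ p ∈ Finset.HasAntidiagonal.antidiagonal m, (-1 : ℂ) ^ (k - m) * L ^ m *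
          (starRingEnd ℂ) (cLi (k - m) z) *
            ((bernoulli p.1 : ℂ) / (p.1.factorial : ℂ) * (1 / (p.2.factorial : ℂ))) := by
        rw [Finset.Nat.sum_antidiagonal_eq_sum_range_succ_mk]
        refine Finset.sum_congr rfl fun i hi ↦ ?_
        have him : i ≤ m := Nat.lt_succ_iff.mp (Finset.mem_range.mp hi)
        have hL : L ^ m = L ^ i * L ^ (m - i) := by rw [← pow_add, Nat.add_sub_cancel' him]
        rw [hL, show k - i - (m - i) = k - m by omega]
        ring
    _ = _ := by
        rw [← Finset.mul_sum, sum_antidiagonal_bernoulli_div_factorial, hsign]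
        ring

theorem reK_half_mul_sub_neg_one_pow_mul_conj (k : ℕ) (w : ℂ) :
    ReK k ((1 / 2 : ℂ) * (w - (-1) ^ k * (starRingEnd ℂ) w)) = ReK k w := by
  rcases Nat.even_or_odd k with he | ho
  · rw [he.neg_one_pow, one_mul, Complex.sub_conj]
    simp [ReK, Nat.not_odd_iff_even.mpr he]
  · rw [ho.neg_one_pow, neg_one_mul, sub_neg_eq_add, Complex.add_conj]
    simp [ReK, ho]

/-- for `k ≥ 1` and `0 < |z| < 1`,
`P_k(z) = ℜ_k( (1/2)·Σ_{i=0}^{k−1} (B_i/i!)·L^i·Li_{k−i}^-(z) )`. -/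
theorem zagierP_eq_half_sum_liMinus (k : ℕ) (hk : 1 ≤ k) (z : ℂ)
    (hz0 : z ≠ 0) (hz : ‖z‖ < 1) :
    zagierP k z =
      ReK k ((1 / 2 : ℂ) * ∑ i ∈ Finset.range k,
        ((bernoulli i : ℂ) / (i.factorial : ℂ)) *
          (Real.log (‖z‖ ^ 2) : ℂ) ^ i * LiMinus (k - i) z) := by
  rw [sum_bernoulli_mul_liMinus, reK_half_mul_sub_neg_one_pow_mul_conj, zagierP]
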